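/- arXiv:1905.03047 — 2 statements merged into one kernel-verified Lean document; each statement's English description precedes it below -/
import Mathlib

section
/- Let n ≥ 5 and let a, b ∈ ℂⁿ have all Plücker coordinates P_{ij} nonzero for i ≠ j. Set z_l = w_{1,2,3,l} for l ∈ {4,…,n}, so that z_i ≠ 0, z_i ≠ 1 and z_i ≠ z_j for distinct i, j ∈ {4,…,n}. Then for all distinct i, j ∈ {4,…,n}: (1) w_{1,2,i,j} = z_j / z_i; (2) w_{1,3,i,j} = (1 − z_j)/(1 − z_i); (3) w_{2,3,i,j} = z_i (1 − z_j)/(z_j (1 − z_i)). -/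
/-- The Plücker coordinate `P_{ij} = a_i b_j - a_j b_i` of a pair of vectors. -/
noncomputable def plucker (a b : ℕ → ℂ) (i j : ℕ) : ℂ :=
  a i * b j - a j * b i

/-- The cross-ratio `w_{i,j,k,l} = (P_{ik} P_{jl}) / (P_{il} P_{jk})`. -/
noncomputable def crossRatio (a b : ℕ → ℂ) (i j k l : ℕ) : ℂ :=
  (plucker a b i k * plucker a b j l) / (plucker a b i l * plucker a b j k)

/-- The three-term Plücker relation. -/
theorem plucker_relation (a b : ℕ → ℂ) (i j k l : ℕ) :
    plucker a b i l * plucker a b j k - plucker a b i k * plucker a b j l =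
      -(plucker a b i j * plucker a b k l) := by
  simp only [plucker]
  ring

/-- The three-term Plücker relation expresses `1 - w_{i,j,k,l}` as a quotient of products. -/
theorem one_sub_crossRatio (a b : ℕ → ℂ) {i j k l : ℕ}
    (hil : plucker a b i l ≠ 0) (hjk : plucker a b j k ≠ 0) :
    1 - crossRatio a b i j k l =
      -(plucker a b i j * plucker a b k l) / (plucker a b i l * plucker a b j k) := by
  rw [crossRatio, one_sub_div (mul_ne_zero hil hjk), plucker_relation]

/-- On the main stratum of `G_{n,2}`, with `z_l = w_{1,2,3,l}`, the cross-ratios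
`w_{1,2,i,j}`, `w_{1,3,i,j}` and `w_{2,3,i,j}` are expressed via `z_i, z_j`. -/
theorem crossRatio_two_small_indices (n : ℕ) (hn : 5 ≤ n) (a b : ℕ → ℂ)
    (hP : ∀ i j : ℕ, 1 ≤ i → i ≤ n → 1 ≤ j → j ≤ n → i ≠ j → plucker a b i j ≠ 0) :
    ∀ i j : ℕ, 4 ≤ i → i ≤ n → 4 ≤ j → j ≤ n → i ≠ j →
      crossRatio a b 1 2 i j = crossRatio a b 1 2 3 j / crossRatio a b 1 2 3 i ∧
      crossRatio a b 1 3 i j =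
        (1 - crossRatio a b 1 2 3 j) / (1 - crossRatio a b 1 2 3 i) ∧
      crossRatio a b 2 3 i j =
        crossRatio a b 1 2 3 i * (1 - crossRatio a b 1 2 3 j)
          / (crossRatio a b 1 2 3 j * (1 - crossRatio a b 1 2 3 i)) := by
  intro i j hi hin hj hjn _
  have h12 := hP 1 2 (by lia) (by lia) (by lia) (by lia) (by lia)
  have h13 := hP 1 3 (by lia) (by lia) (by lia) (by lia) (by lia)
  have h23 := hP 2 3 (by lia) (by lia) (by lia) (by lia) (by lia)
  have h1i := hP 1 i (by lia) (by lia) (by lia) (by lia) (by lia)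
  have h2i := hP 2 i (by lia) (by lia) (by lia) (by lia) (by lia)
  have h3i := hP 3 i (by lia) (by lia) (by lia) (by lia) (by lia)
  have h1j := hP 1 j (by lia) (by lia) (by lia) (by lia) (by lia)
  have h2j := hP 2 j (by lia) (by lia) (by lia) (by lia) (by lia)
  rw [one_sub_crossRatio a b h1i h23, one_sub_crossRatio a b h1j h23]
  simp only [crossRatio]
  refine ⟨?_, ?_, ?_⟩ <;> field_simp
end

section
/- Let n ≥ 7 and let a, b ∈ ℂⁿ have all Plücker coordinates P_{ij} nonzero for i ≠ j. Set z_l = w_{1,2,3,l} for l ∈ {4,…,n}, so that z_i ≠ 0, z_i ≠ 1 and z_i ≠ z_j for distinct i, j ∈ {4,…,n}. Then for all i, j, k, l ∈ {4,…,n} with i < j < k < l: w_{i,j,k,l} = ((z_i − z_k)(z_j − z_l))/((z_i − z_l)(z_j − z_k)). -/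
/-- The three-term Plücker relation. -/
theorem plucker_mul_sub_plucker_mul (a b : ℕ → ℂ) (p q s t : ℕ) :
    plucker a b p t * plucker a b q s - plucker a b p s * plucker a b q t =
      -(plucker a b p q * plucker a b s t) := by
  simp only [plucker]
  ring

/-- The difference of two cross-ratios that differ only in the last index. -/
theorem crossRatio_sub_crossRatio (a b : ℕ → ℂ) {p q r s t : ℕ}
    (hs : plucker a b p s ≠ 0) (ht : plucker a b p t ≠ 0) :
    crossRatio a b p q r s - crossRatio a b p q r t =
      -(plucker a b p r * plucker a b p q / plucker a b q r) *
        (plucker a b s t / (plucker a b p s * plucker a b p t)) := by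
  have key := plucker_mul_sub_plucker_mul a b p q s t
  calc
    _ = plucker a b p r / plucker a b q r *
        ((plucker a b p t * plucker a b q s - plucker a b p s * plucker a b q t) /
          (plucker a b p s * plucker a b p t)) := by
      simp only [crossRatio]
      field_simp
    _ = _ := by
      rw [key]
      ring

/-- On the main stratum of `G_{n,2}`, with `z_l = w_{1,2,3,l}`, the cross-ratio
`w_{i,j,k,l}` for `4 ≤ i < j < k < l ≤ n` equals
`((z_i − z_k)(z_j − z_l)) / ((z_i − z_l)(z_j − z_k))`. -/
theorem crossRatio_big_indices (n : ℕ) (hn : 7 ≤ n) (a b : ℕ → ℂ)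
    (hP : ∀ i j : ℕ, 1 ≤ i → i ≤ n → 1 ≤ j → j ≤ n → i ≠ j → plucker a b i j ≠ 0) :
    ∀ i j k l : ℕ, 4 ≤ i → i < j → j < k → k < l → l ≤ n →
      crossRatio a b i j k l =
        ((crossRatio a b 1 2 3 i - crossRatio a b 1 2 3 k)
            * (crossRatio a b 1 2 3 j - crossRatio a b 1 2 3 l))
          / ((crossRatio a b 1 2 3 i - crossRatio a b 1 2 3 l)
              * (crossRatio a b 1 2 3 j - crossRatio a b 1 2 3 k)) := by
  intro i j k l hi hij hjk hkl hl
  have h1 (m : ℕ) (hm : 4 ≤ m) (hmn : m ≤ n) : plucker a b 1 m ≠ 0 :=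
    hP 1 m (by omega) (by omega) (by omega) hmn (by omega)
  have h1i := h1 i hi (by omega)
  have h1j := h1 j (by omega) (by omega)
  have h1k := h1 k (by omega) (by omega)
  have h1l := h1 l (by omega) hl
  have h12 : plucker a b 1 2 ≠ 0 := hP 1 2 (by omega) (by omega) (by omega) (by omega) (by omega)
  have h13 : plucker a b 1 3 ≠ 0 := hP 1 3 (by omega) (by omega) (by omega) (by omega) (by omega)
  have h23 : plucker a b 2 3 ≠ 0 := hP 2 3 (by omega) (by omega) (by omega) (by omega) (by omega)
  have hil : plucker a b i l ≠ 0 := hP i l (by omega) (by omega) (by omega) hl (by omega)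
  have hjk' : plucker a b j k ≠ 0 := hP j k (by omega) (by omega) (by omega) (by omega) (by omega)
  rw [crossRatio_sub_crossRatio a b h1i h1k, crossRatio_sub_crossRatio a b h1j h1l,
    crossRatio_sub_crossRatio a b h1i h1l, crossRatio_sub_crossRatio a b h1j h1k, crossRatio]
  field_simp
end
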